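/- Adjointness of the discrete gradient and discrete divergence: for every v_h ∈ P₀ and every q_h ∈ P₁^{nc}, one has (v_h, ∇_h q_h) = −(q_h, div_h v_h), where (·,·) is the L²(Ω) inner product. -/

import Mathlib

open scoped RealInnerProductSpace
open MeasureTheory

attribute [local instance] Classical.propDecidable

noncomputable section

/-- The Euclidean plane. -/
abbrev E2 : Type := EuclideanSpace ℝ (Fin 2)

/-- A nondegenerate (closed) triangle of the plane, given by its three
affinely independent vertices. -/
structure Tri : Type where
  vtx : Fin 3 → E2
  indep : AffineIndependent ℝ vtx

namespace Tri

/-- The triangle as a subset of the plane: the convex hull of its vertices. -/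
def carrier (t : Tri) : Set E2 := convexHull ℝ (Set.range t.vtx)

/-- The area `|K|` of the triangle. -/
def area (t : Tri) : ℝ := (volume t.carrier).toReal

/-- The centroid of the triangle. -/
def centroid (t : Tri) : E2 := Finset.centroid ℝ Finset.univ t.vtx

/-- The triangle seen as a 2-simplex. -/
def simplex (t : Tri) : Affine.Simplex ℝ E2 2 := ⟨t.vtx, t.indep⟩

/-- The circumcenter `x_K` of the triangle. -/
def ccenter (t : Tri) : E2 := t.simplex.circumcenter

/-- `σ` (an ordered pair of distinct points) is an edge of the triangle `t`:
both of its endpoints are vertices of `t`. -/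
def hasEdge (t : Tri) (σ : E2 × E2) : Prop :=
  σ.1 ≠ σ.2 ∧ σ.1 ∈ Set.range t.vtx ∧ σ.2 ∈ Set.range t.vtx

end Tri

/-- The segment of an edge. -/
def eseg (σ : E2 × E2) : Set E2 := segment ℝ σ.1 σ.2

/-- The length `|σ|` of an edge. -/
def elen (σ : E2 × E2) : ℝ := dist σ.1 σ.2

/-- The midpoint `x_σ` of an edge. -/
def emid (σ : E2 × E2) : E2 := midpoint ℝ σ.1 σ.2

/-- Rotation by `π/2` in the plane. -/
def perp (x : E2) : E2 := (EuclideanSpace.equiv (Fin 2) ℝ).symm ![-(x 1), x 0]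

/-- The unit normal `n_{K,σ}` to the edge `σ`, pointing outward of the triangle `t`. -/
def Tri.nrm (t : Tri) (σ : E2 × E2) : E2 :=
  if 0 ≤ ⟪perp (σ.2 - σ.1), emid σ - t.centroid⟫
  then (elen σ)⁻¹ • perp (σ.2 - σ.1)
  else -((elen σ)⁻¹ • perp (σ.2 - σ.1))

/-- An admissible triangulation `𝒯_h` of `Ω`, together with a registration of its
edges (each geometric edge is recorded once, with a chosen orientation) and a labelling
`K_σ`, `L_σ` of the triangle(s) adjacent to each edge.  All interior angles of all
triangles are `< π/2`. -/
structure Mesh (Ω : Set E2) : Type where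
  tris : Finset Tri
  tris_nonempty : tris.Nonempty
  edges : Finset (E2 × E2)
  Kof : E2 × E2 → Tri
  Lof : E2 × E2 → Tri
  interior_disjoint : ∀ t₁ ∈ tris, ∀ t₂ ∈ tris, t₁ ≠ t₂ →
    interior t₁.carrier ∩ interior t₂.carrier = ∅
  union_eq : ⋃ t ∈ (tris : Set Tri), t.carrier = closure Ω
  inter_structure : ∀ t₁ ∈ tris, ∀ t₂ ∈ tris, t₁ ≠ t₂ →
    t₁.carrier ∩ t₂.carrier = ∅
    ∨ (∃ a ∈ Set.range t₁.vtx ∩ Set.range t₂.vtx, t₁.carrier ∩ t₂.carrier = {a})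
    ∨ (∃ σ, t₁.hasEdge σ ∧ t₂.hasEdge σ ∧ t₁.carrier ∩ t₂.carrier = eseg σ)
  angles_lt : ∀ t ∈ tris, ∀ i j l : Fin 3, i ≠ j → i ≠ l → j ≠ l →
    EuclideanGeometry.angle (t.vtx j) (t.vtx i) (t.vtx l) < Real.pi / 2
  edges_ne : ∀ σ ∈ edges, σ.1 ≠ σ.2
  edges_cover : ∀ t ∈ tris, ∀ i j : Fin 3, i ≠ j →
    (t.vtx i, t.vtx j) ∈ edges ∨ (t.vtx j, t.vtx i) ∈ edges
  edges_sub : ∀ σ ∈ edges, ∃ t ∈ tris, t.hasEdge σ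
  edges_orient : ∀ σ ∈ edges, Prod.swap σ ∉ edges
  edges_atMostTwo : ∀ σ ∈ edges, (tris.filter fun t => t.hasEdge σ).card ≤ 2
  Kof_mem : ∀ σ ∈ edges, Kof σ ∈ tris ∧ (Kof σ).hasEdge σ
  Lof_mem : ∀ σ ∈ edges, (tris.filter fun t => t.hasEdge σ).card = 2 →
    Lof σ ∈ tris ∧ (Lof σ).hasEdge σ ∧ Lof σ ≠ Kof σ
  ext_frontier : ∀ σ ∈ edges, (tris.filter fun t => t.hasEdge σ).card = 1 →
    eseg σ ⊆ frontier Ω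

namespace Mesh

variable {Ω : Set E2} (M : Mesh Ω)

/-- The interior edges `ℰ_h^int` (shared by exactly two triangles). -/
def intEdges : Finset (E2 × E2) :=
  M.edges.filter fun σ => (M.tris.filter fun t => t.hasEdge σ).card = 2

/-- The boundary edges `ℰ_h^ext`. -/
def extEdges : Finset (E2 × E2) :=
  M.edges.filter fun σ => (M.tris.filter fun t => t.hasEdge σ).card = 1

/-- `d_σ`: distance between the circumcenters of the two triangles sharing `σ`
(interior edges), or from the circumcenter of `K_σ` to the midpoint of `σ`
(boundary edges). -/
def dOf (σ : E2 × E2) : ℝ :=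
  if (M.tris.filter fun t => t.hasEdge σ).card = 2
  then dist (M.Kof σ).ccenter (M.Lof σ).ccenter
  else dist (M.Kof σ).ccenter (emid σ)

/-- `τ_σ = |σ| / d_σ`. -/
def tau (σ : E2 × E2) : ℝ := elen σ / M.dOf σ

/-- The mesh size `h`: the largest diameter of a circumscribed circle. -/
def meshSize : ℝ := M.tris.sup' M.tris_nonempty fun t => 2 * t.simplex.circumradius

/-- Mesh regularity with constant `C_reg`: `d_σ ≥ C_reg |σ|` and `|σ| ≥ C_reg h`. -/
def Regular (Creg : ℝ) : Prop :=
  ∀ σ ∈ M.edges, Creg * elen σ ≤ M.dOf σ ∧ Creg * M.meshSize ≤ elen σ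

/-- For `σ` an edge of `t`, the triangle on the other side of `σ`. -/
def other (t : Tri) (σ : E2 × E2) : Tri := if M.Kof σ = t then M.Lof σ else M.Kof σ

/-- The `L²(Ω)` inner product of two piecewise constant (`P₀`) fields. -/
def l2P0 (v w : Tri → E2) : ℝ := ∑ t ∈ M.tris, t.area * ⟪v t, w t⟫

/-- The `L²(Ω)` norm of a `P₀` field. -/
def l2normP0 (v : Tri → E2) : ℝ := Real.sqrt (M.l2P0 v v)

/-- The discrete `H¹` norm `‖·‖_h` on `P₀`. -/
def normh (v : Tri → E2) : ℝ :=
  Real.sqrt (∑ σ ∈ M.intEdges, M.tau σ * ‖v (M.Lof σ) - v (M.Kof σ)‖ ^ 2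
    + ∑ σ ∈ M.extEdges, M.tau σ * ‖v (M.Kof σ)‖ ^ 2)

/-- A family of affine maps (one per triangle) is in `P₁^{nc}`: the two traces agree
at the midpoint of every interior edge. -/
def IsP1nc (q : Tri → (E2 →ᵃ[ℝ] ℝ)) : Prop :=
  ∀ σ ∈ M.intEdges, q (M.Kof σ) (emid σ) = q (M.Lof σ) (emid σ)

/-- Membership in `L²₀`: the piecewise affine function has zero mean on `Ω`. -/
def MeanZero (q : Tri → (E2 →ᵃ[ℝ] ℝ)) : Prop :=
  ∑ t ∈ M.tris, ∫ x in t.carrier, q t x = 0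

/-- The `L²(Ω)` inner product of two piecewise affine functions. -/
def l2P1 (q r : Tri → (E2 →ᵃ[ℝ] ℝ)) : ℝ :=
  ∑ t ∈ M.tris, ∫ x in t.carrier, q t x * r t x

/-- The `L²(Ω)` norm of a piecewise affine function. -/
def l2normP1 (q : Tri → (E2 →ᵃ[ℝ] ℝ)) : ℝ := Real.sqrt (M.l2P1 q q)

end Mesh

/-- The gradient (a constant vector) of an affine function on the plane. -/
def gradA (f : E2 →ᵃ[ℝ] ℝ) : E2 :=
  (InnerProductSpace.toDual ℝ E2).symm (LinearMap.toContinuousLinearMap f.linear)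

/-- The discrete gradient `∇_h q` of a piecewise affine function: the piecewise
constant field equal on each triangle to the gradient of the affine piece. -/
def gradh (q : Tri → (E2 →ᵃ[ℝ] ℝ)) : Tri → E2 := fun t => gradA (q t)

/-- The (constant) divergence of an affine vector field of the plane. -/
def divA (f : E2 →ᵃ[ℝ] E2) : ℝ := LinearMap.trace ℝ E2 f.linear

/-- The normal component `(u·n_{K,σ})_σ` of a piecewise affine field on the edge `σ`
of the triangle `t` (evaluated at the midpoint of `σ`). -/
def unrm (u : Tri → (E2 →ᵃ[ℝ] E2)) (t : Tri) (σ : E2 × E2) : ℝ :=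
  ⟪u t (emid σ), t.nrm σ⟫

namespace Mesh

variable {Ω : Set E2} (M : Mesh Ω)

/-- The norm `‖q‖_{1,h} = (|q|² + |∇_h q|²)^{1/2}` on `P₁^{nc}`. -/
def norm1h (q : Tri → (E2 →ᵃ[ℝ] ℝ)) : ℝ :=
  Real.sqrt ((M.l2normP1 q) ^ 2 + (M.l2normP0 (gradh q)) ^ 2)

/-- The prescribed value of `div_h v` at the midpoint of the edge `σ`. -/
def divhImage (v : Tri → E2) (σ : E2 × E2) : ℝ :=
  if (M.tris.filter fun t => t.hasEdge σ).card = 2 then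
    (3 * elen σ / ((M.Kof σ).area + (M.Lof σ).area)) *
      ⟪v (M.Lof σ) - v (M.Kof σ), (M.Kof σ).nrm σ⟫
  else
    -((3 * elen σ / (M.Kof σ).area) * ⟪v (M.Kof σ), (M.Kof σ).nrm σ⟫)

/-- `d = div_h v`: `d` is the element of `P₁^{nc}` taking the prescribed values at
the midpoints of the edges. -/
def IsDivh (v : Tri → E2) (d : Tri → (E2 →ᵃ[ℝ] ℝ)) : Prop :=
  M.IsP1nc d ∧
    ∀ t ∈ M.tris, ∀ σ ∈ M.edges, t.hasEdge σ → d t (emid σ) = M.divhImage v σ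

/-- The discrete Laplacian `Δ̃_h` on `P₀`. -/
def laph (v : Tri → E2) : Tri → E2 := fun t =>
  (t.area)⁻¹ •
    ((∑ σ ∈ M.intEdges.filter fun σ => t.hasEdge σ, M.tau σ • (v (M.other t σ) - v t))
      - ∑ σ ∈ M.extEdges.filter fun σ => t.hasEdge σ, M.tau σ • v t)

/-- The upwind convection operator `b̃_h(u_h, v_h) ∈ P₀`. -/
def btilde (u : Tri → (E2 →ᵃ[ℝ] E2)) (v : Tri → E2) : Tri → E2 := fun t =>
  (t.area)⁻¹ • ∑ σ ∈ M.intEdges.filter fun σ => t.hasEdge σ,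
    elen σ • (max (unrm u t σ) 0 • v t + min (unrm u t σ) 0 • v (M.other t σ))

/-- The trilinear form `b_h(u_h, v_h, w_h)`. -/
def bh (u : Tri → (E2 →ᵃ[ℝ] E2)) (v w : Tri → E2) : ℝ :=
  ∑ t ∈ M.tris, t.area * ⟪w t, M.btilde u v t⟫

/-- Membership in the lowest-order Raviart–Thomas space `RT₀`: the normal component is
constant on each edge of each triangle, matches across interior edges and vanishes on
boundary edges. -/
def IsRT0 (u : Tri → (E2 →ᵃ[ℝ] E2)) : Prop :=
  (∀ t ∈ M.tris, ∀ σ ∈ M.edges, t.hasEdge σ → ∀ x ∈ eseg σ,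
      ⟪u t x, t.nrm σ⟫ = unrm u t σ)
  ∧ (∀ σ ∈ M.intEdges,
      ⟪u (M.Kof σ) (emid σ), (M.Kof σ).nrm σ⟫ =
        ⟪u (M.Lof σ) (emid σ), (M.Kof σ).nrm σ⟫)
  ∧ (∀ σ ∈ M.extEdges, unrm u (M.Kof σ) σ = 0)

/-- Membership of a piecewise constant field in `P₀ ∩ RT₀`. -/
def IsRT0const (v : Tri → E2) : Prop :=
  (∀ σ ∈ M.intEdges, ⟪v (M.Lof σ) - v (M.Kof σ), (M.Kof σ).nrm σ⟫ = 0)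
  ∧ ∀ σ ∈ M.extEdges, ⟪v (M.Kof σ), (M.Kof σ).nrm σ⟫ = 0

/-- The `L²(Ω)` norm of a piecewise affine vector field. -/
def l2normRT (u : Tri → (E2 →ᵃ[ℝ] E2)) : ℝ :=
  Real.sqrt (∑ t ∈ M.tris, ∫ x in t.carrier, ‖u t x‖ ^ 2)

end Mesh

/-- Cross product of the plane. -/
def crs (u w : E2) : ℝ := u 0 * w 1 - u 1 * w 0

/-- The reference triangle in the product space. -/
def refT : Set (ℝ × ℝ) := {x | 0 ≤ x.1 ∧ 0 ≤ x.2 ∧ x.1 + x.2 ≤ 1}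

theorem refT_meas : IsClosed refT := by
  have h1 : IsClosed {x : ℝ × ℝ | 0 ≤ x.1} := isClosed_le continuous_const continuous_fst
  have h2 : IsClosed {x : ℝ × ℝ | 0 ≤ x.2} := isClosed_le continuous_const continuous_snd
  have h3 : IsClosed {x : ℝ × ℝ | x.1 + x.2 ≤ 1} :=
    isClosed_le (continuous_fst.add continuous_snd) continuous_const
  exact h1.inter (h2.inter h3)

theorem refT_compact : IsCompact refT := by
  refine IsCompact.of_isClosed_subset (isCompact_Icc (a := ((0 : ℝ), (0 : ℝ))) (b := (1, 1)))
    refT_meas ?_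
  rintro ⟨x, y⟩ ⟨h1, h2, h3⟩
  simp only at h1 h2 h3
  exact ⟨⟨h1, h2⟩, ⟨by simp only; linarith, by simp only; linarith⟩⟩

theorem refT_integral (f : ℝ × ℝ → ℝ) (hf : Continuous f) :
    ∫ z in refT, f z = ∫ x in (0 : ℝ)..1, ∫ y in (0 : ℝ)..(1 - x), f (x, y) := by
  have hi : IntegrableOn f refT := hf.continuousOn.integrableOn_compact refT_compact
  rw [← integral_indicator refT_meas.measurableSet]
  have hi' : Integrable (refT.indicator f) := hi.integrable_indicator refT_meas.measurableSet
  rw [Measure.volume_eq_prod] at hi' ⊢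
  rw [integral_prod _ hi']
  rw [intervalIntegral.integral_of_le zero_le_one, ← integral_Icc_eq_integral_Ioc,
    ← integral_indicator measurableSet_Icc]
  congr 1
  ext x
  by_cases hx : x ∈ Set.Icc (0 : ℝ) 1
  · rw [Set.indicator_of_mem hx]
    rw [intervalIntegral.integral_of_le (by linarith [hx.2]), ← integral_Icc_eq_integral_Ioc,
      ← integral_indicator measurableSet_Icc]
    congr 1
    ext y
    by_cases hy : y ∈ Set.Icc (0 : ℝ) (1 - x)
    · rw [Set.indicator_of_mem hy, Set.indicator_of_mem]
      exact ⟨hx.1, hy.1, by simp only; linarith [hy.2]⟩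
    · rw [Set.indicator_of_notMem hy, Set.indicator_of_notMem]
      rintro ⟨h1, h2, h3⟩
      exact hy ⟨h2, by simp only at h3; linarith⟩
  · rw [Set.indicator_of_notMem hx]
    have : ∀ y, refT.indicator f (x, y) = 0 := by
      intro y
      rw [Set.indicator_of_notMem]
      rintro ⟨h1, h2, h3⟩
      simp only at h1 h2 h3
      exact hx ⟨h1, by linarith⟩
    simp [this]

theorem refT_quad (a b c a' b' c' : ℝ) :
    ∫ z in refT, (a + b * z.1 + c * z.2) * (a' + b' * z.1 + c' * z.2) =
      ((a + b / 2) * (a' + b' / 2) + (a + c / 2) * (a' + c' / 2)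
        + (a + b / 2 + c / 2) * (a' + b' / 2 + c' / 2)) / 6 := by
  rw [refT_integral _ (by fun_prop)]
  simp only
  have h1 : ∀ x : ℝ, ∫ y in (0 : ℝ)..(1 - x), (a + b * x + c * y) * (a' + b' * x + c' * y) =
      (a + b * x) * (a' + b' * x) * (1 - x)
      + ((a + b * x) * c' + c * (a' + b' * x)) * (1 - x) ^ 2 / 2
      + c * c' * (1 - x) ^ 3 / 3 := by
    intro x
    rw [intervalIntegral.integral_eq_sub_of_hasDerivAt
      (f := fun y => (a + b * x) * (a' + b' * x) * y
        + ((a + b * x) * c' + c * (a' + b' * x)) * y ^ 2 / 2 + c * c' * y ^ 3 / 3)]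
    · simp
    · intro y _
      have := (((hasDerivAt_id y).const_mul ((a + b * x) * (a' + b' * x))).add
        ((((hasDerivAt_id y).pow 2).const_mul ((a + b * x) * c' + c * (a' + b' * x))).div_const 2)).add
        ((((hasDerivAt_id y).pow 3).const_mul (c * c')).div_const 3)
      refine this.congr_deriv ?_
      simp; ring
    · exact Continuous.intervalIntegrable (by fun_prop) _ _
  simp only [h1]
  rw [intervalIntegral.integral_eq_sub_of_hasDerivAt
      (f := fun x =>
        (a * a' + (a * c' + c * a') / 2 + c * c' / 3) * x
        + (a * b' + b * a' - a * a' + ((b * c' + c * b') - 2 * (a * c' + c * a')) / 2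
            - c * c') * x ^ 2 / 2
        + (b * b' - (a * b' + b * a') + ((a * c' + c * a') - 2 * (b * c' + c * b')) / 2
            + c * c') * x ^ 3 / 3
        + (- (b * b') + (b * c' + c * b') / 2 - c * c' / 3) * x ^ 4 / 4)]
  · ring
  · intro x _
    have := ((((hasDerivAt_id x).const_mul
        (a * a' + (a * c' + c * a') / 2 + c * c' / 3)).add
        ((((hasDerivAt_id x).pow 2).const_mul
          (a * b' + b * a' - a * a' + ((b * c' + c * b') - 2 * (a * c' + c * a')) / 2
            - c * c')).div_const 2)).add
        ((((hasDerivAt_id x).pow 3).const_mul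
          (b * b' - (a * b' + b * a') + ((a * c' + c * a') - 2 * (b * c' + c * b')) / 2
            + c * c')).div_const 3)).add
        ((((hasDerivAt_id x).pow 4).const_mul
          (- (b * b') + (b * c' + c * b') / 2 - c * c' / 3)).div_const 4)
    refine this.congr_deriv ?_
    simp; ring
  · exact Continuous.intervalIntegrable (by fun_prop) _ _

theorem crs_ne (t : Tri) : crs (t.vtx 1 - t.vtx 0) (t.vtx 2 - t.vtx 0) ≠ 0 := by
  intro h
  have hi := (affineIndependent_iff_linearIndependent_vsub ℝ t.vtx 0).1 t.indep
  have hp : LinearIndependent ℝ ![t.vtx 1 - t.vtx 0, t.vtx 2 - t.vtx 0] := by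
    have := hi.comp (fun i : Fin 2 => (⟨i.succ, Fin.succ_ne_zero i⟩ : {x : Fin 3 // x ≠ 0}))
      (by intro i j hij; simpa using hij)
    have e : ![t.vtx 1 - t.vtx 0, t.vtx 2 - t.vtx 0] = (fun i : {x : Fin 3 // x ≠ 0} =>
        t.vtx i -ᵥ t.vtx 0) ∘
        (fun i : Fin 2 => (⟨i.succ, Fin.succ_ne_zero i⟩ : {x : Fin 3 // x ≠ 0})) := by
      ext i j
      fin_cases i <;> simp
    rw [e]
    exact this
  rw [LinearIndependent.pair_iff] at hp
  set u := t.vtx 1 - t.vtx 0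
  set w := t.vtx 2 - t.vtx 0
  unfold crs at h
  have h1 := hp (w 1) (-(u 1)) (by
    ext i; fin_cases i <;> simp <;> linarith)
  have h0 := hp (w 0) (-(u 0)) (by
    ext i; fin_cases i <;> simp <;> linarith)
  have := hp 1 0 (by
    ext i; fin_cases i <;> simp <;> linarith)
  exact one_ne_zero this.1

/-- The parametrisation of a triangle. -/
def par (t : Tri) (x : E2) : E2 :=
  t.vtx 0 + (x 0 • (t.vtx 1 - t.vtx 0) + x 1 • (t.vtx 2 - t.vtx 0))

def parMat (t : Tri) : Matrix (Fin 2) (Fin 2) ℝ :=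
  !![(t.vtx 1 - t.vtx 0) 0, (t.vtx 2 - t.vtx 0) 0; (t.vtx 1 - t.vtx 0) 1, (t.vtx 2 - t.vtx 0) 1]

def parL (t : Tri) : E2 →L[ℝ] E2 := LinearMap.toContinuousLinearMap
  (Matrix.toLin (EuclideanSpace.basisFun (Fin 2) ℝ).toBasis (EuclideanSpace.basisFun (Fin 2) ℝ).toBasis
    (parMat t))

theorem parL_apply (t : Tri) (x : E2) :
    parL t x = x 0 • (t.vtx 1 - t.vtx 0) + x 1 • (t.vtx 2 - t.vtx 0) := by
  ext i
  fin_cases i <;>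
  simp [parL, parMat, Matrix.toLin_apply, Fin.sum_univ_two, Matrix.mulVec, dotProduct,
    EuclideanSpace.basisFun_apply, OrthonormalBasis.coe_toBasis] <;> ring

theorem parL_det (t : Tri) : (parL t).det = crs (t.vtx 1 - t.vtx 0) (t.vtx 2 - t.vtx 0) := by
  unfold ContinuousLinearMap.det parL
  rw [LinearMap.coe_toContinuousLinearMap, LinearMap.det_toLin]
  simp [parMat, Matrix.det_fin_two, crs]; ring

theorem par_eq (t : Tri) (x : E2) : par t x = t.vtx 0 + parL t x := by
  rw [par, parL_apply]

theorem par_inj (t : Tri) : Function.Injective (par t) := by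
  intro x y h
  have hD := crs_ne t
  simp only [par, add_right_inj] at h
  have e0 := congrArg (fun z : E2 => z 0) h
  have e1 := congrArg (fun z : E2 => z 1) h
  set u := t.vtx 1 - t.vtx 0
  set w := t.vtx 2 - t.vtx 0
  simp only [PiLp.add_apply, PiLp.smul_apply, smul_eq_mul] at e0 e1
  unfold crs at hD
  ext i
  fin_cases i
  · apply mul_right_cancel₀ hD; simp only [Fin.zero_eta]; linear_combination w 1 * e0 - w 0 * e1
  · apply mul_right_cancel₀ hD; simp only [Fin.mk_one]; linear_combination u 0 * e1 - u 1 * e0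

/-- Coordinates. -/
def cpr (x : E2) : ℝ × ℝ := (x 0, x 1)

theorem cpr_mp : MeasurePreserving cpr := by
  exact (volume_preserving_finTwoArrow ℝ).comp
    (EuclideanSpace.volume_preserving_symm_measurableEquiv_toLp (Fin 2))

theorem cpr_emb : MeasurableEmbedding cpr :=
  ((MeasurableEquiv.toLp 2 (Fin 2 → ℝ)).symm.trans
    (MeasurableEquiv.finTwoArrow (α := ℝ))).measurableEmbedding

theorem carrier_eq (t : Tri) : t.carrier = par t '' (cpr ⁻¹' refT) := by
  unfold Tri.carrier
  apply Set.Subset.antisymm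
  · apply convexHull_min
    · rintro _ ⟨i, rfl⟩
      fin_cases i
      · exact ⟨!₂[0, 0], by simp [cpr, refT], by simp [par]⟩
      · exact ⟨!₂[1, 0], by simp [cpr, refT], by simp [par]⟩
      · exact ⟨!₂[0, 1], by simp [cpr, refT], by simp [par]⟩
    · rintro _ ⟨x, ⟨hx0, hx1, hx2⟩, rfl⟩ _ ⟨y, ⟨hy0, hy1, hy2⟩, rfl⟩ a b ha hb hab
      simp only [cpr] at hx0 hx1 hx2 hy0 hy1 hy2
      refine ⟨a • x + b • y, ⟨?_, ?_, ?_⟩, ?_⟩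
      · simp only [cpr, PiLp.add_apply, PiLp.smul_apply, smul_eq_mul]; positivity
      · simp only [cpr, PiLp.add_apply, PiLp.smul_apply, smul_eq_mul]; positivity
      · simp only [cpr, PiLp.add_apply, PiLp.smul_apply, smul_eq_mul]
        nlinarith
      · obtain rfl : b = 1 - a := by linarith
        simp only [par, PiLp.add_apply, PiLp.smul_apply, smul_eq_mul]
        module
  · rintro _ ⟨x, ⟨hx0, hx1, hx2⟩, rfl⟩
    simp only [cpr] at hx0 hx1 hx2
    have hc := convex_convexHull ℝ (Set.range t.vtx)
    have := hc.sum_mem (t := Finset.univ) (w := ![1 - x 0 - x 1, x 0, x 1]) (z := t.vtx)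
      (by intro i _; fin_cases i <;> simp <;> linarith)
      (by simp [Fin.sum_univ_three]; ring)
      (by intro i _; exact subset_convexHull _ _ ⟨i, rfl⟩)
    convert this using 1
    simp [Fin.sum_univ_three, par]
    module

theorem tri_integral (t : Tri) (g : E2 → ℝ) (h : ℝ × ℝ → ℝ) (hg : ∀ x, g (par t x) = h (cpr x)) :
    ∫ x in t.carrier, g x
      = |crs (t.vtx 1 - t.vtx 0) (t.vtx 2 - t.vtx 0)| * ∫ z in refT, h z := by
  rw [carrier_eq]
  have hm : MeasurableSet (cpr ⁻¹' refT) := cpr_mp.measurable refT_meas.measurableSet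
  rw [integral_image_eq_integral_abs_det_fderiv_smul (f' := fun _ => parL t) volume hm _
    (par_inj t).injOn]
  · simp only [parL_det, smul_eq_mul, hg]
    rw [integral_const_mul, cpr_mp.setIntegral_preimage_emb cpr_emb]
  · intro x _
    have : par t = fun x => t.vtx 0 + parL t x := funext (par_eq t)
    rw [this]
    exact ((parL t).hasFDerivAt.const_add _).hasFDerivWithinAt

theorem area_eq (t : Tri) :
    t.area = |crs (t.vtx 1 - t.vtx 0) (t.vtx 2 - t.vtx 0)| / 2 := by
  have h1 : t.area = ∫ x in t.carrier, (1 : ℝ) := by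
    simp [Tri.area, Measure.real]
  rw [h1, tri_integral t (fun _ => 1)
    (fun z => (1 + 0 * z.1 + 0 * z.2) * (1 + 0 * z.1 + 0 * z.2)) (by simp), refT_quad]
  ring

theorem par_affine (t : Tri) (q : E2 →ᵃ[ℝ] ℝ) (x : E2) :
    q (par t x) = q (t.vtx 0) + (q (t.vtx 1) - q (t.vtx 0)) * (cpr x).1
      + (q (t.vtx 2) - q (t.vtx 0)) * (cpr x).2 := by
  have e : par t x = (x 0 • (t.vtx 1 - t.vtx 0) + x 1 • (t.vtx 2 - t.vtx 0)) +ᵥ t.vtx 0 := by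
    rw [par, vadd_eq_add, add_comm]
  have h1 := q.linearMap_vsub (t.vtx 1) (t.vtx 0)
  have h2 := q.linearMap_vsub (t.vtx 2) (t.vtx 0)
  simp only [vsub_eq_sub] at h1 h2
  rw [e, AffineMap.map_vadd, map_add, map_smul, map_smul, h1, h2]
  simp [cpr]; ring

theorem emid_affine (q : E2 →ᵃ[ℝ] ℝ) (p r : E2) : q (emid (p, r)) = (q p + q r) / 2 := by
  unfold emid
  rw [AffineMap.map_midpoint, midpoint_eq_smul_add]
  simp; ring

theorem midpoint_rule (t : Tri) (q d : E2 →ᵃ[ℝ] ℝ) :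
    ∫ x in t.carrier, q x * d x = t.area / 3 *
      (q (emid (t.vtx 0, t.vtx 1)) * d (emid (t.vtx 0, t.vtx 1))
      + q (emid (t.vtx 1, t.vtx 2)) * d (emid (t.vtx 1, t.vtx 2))
      + q (emid (t.vtx 2, t.vtx 0)) * d (emid (t.vtx 2, t.vtx 0))) := by
  rw [tri_integral t _ (fun z => (q (t.vtx 0) + (q (t.vtx 1) - q (t.vtx 0)) * z.1
      + (q (t.vtx 2) - q (t.vtx 0)) * z.2) * (d (t.vtx 0) + (d (t.vtx 1) - d (t.vtx 0)) * z.1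
      + (d (t.vtx 2) - d (t.vtx 0)) * z.2)) (fun x => by rw [par_affine, par_affine]),
    refT_quad, area_eq]
  simp only [emid_affine]
  ring

theorem inner_perp (u w : E2) : ⟪perp u, w⟫ = crs u w := by
  simp [perp, crs, PiLp.inner_apply, Fin.sum_univ_two]; ring

theorem centroid_eq (t : Tri) : t.centroid = (1 / 3 : ℝ) • (t.vtx 0 + t.vtx 1 + t.vtx 2) := by
  unfold Tri.centroid
  rw [Finset.centroid_def, Finset.affineCombination_eq_linear_combination _ _ _
    (Finset.sum_centroidWeights_eq_one_of_card_ne_zero ℝ _ (by simp))]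
  simp [Fin.sum_univ_three, Finset.centroidWeights]

theorem sum_perm (t : Tri) (i j k : Fin 3) (hij : i ≠ j) (hik : i ≠ k) (hjk : j ≠ k) :
    t.vtx 0 + t.vtx 1 + t.vtx 2 = t.vtx i + t.vtx j + t.vtx k := by
  have h : (Finset.univ : Finset (Fin 3)) = {i, j, k} := by
    revert i j k; decide
  have e := Fin.sum_univ_three t.vtx
  rw [← e, h, Finset.sum_insert (by simp [hij, hik]), Finset.sum_insert (by simp [hjk]),
    Finset.sum_singleton, add_assoc]

theorem crs_ne' (t : Tri) (i j k : Fin 3) (hij : i ≠ j) (hik : i ≠ k) (hjk : j ≠ k) :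
    crs (t.vtx i - t.vtx k) (t.vtx j - t.vtx k) ≠ 0 := by
  have h := crs_ne t
  contrapose! h
  simp only [crs, PiLp.sub_apply] at h ⊢
  fin_cases i <;> fin_cases j <;> fin_cases k <;> simp at hij hik hjk h ⊢ <;> linarith

theorem nrm_eq (t : Tri) (i j k : Fin 3) (hij : i ≠ j) (hik : i ≠ k) (hjk : j ≠ k) :
    elen (t.vtx i, t.vtx j) • t.nrm (t.vtx i, t.vtx j) =
      (if crs (t.vtx i - t.vtx k) (t.vtx j - t.vtx k) ≤ 0 then (1 : ℝ) else -1)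
        • perp (t.vtx j - t.vtx i) := by
  have hne : elen (t.vtx i, t.vtx j) ≠ 0 := by
    unfold elen
    exact dist_ne_zero.2 (fun h => hij (t.indep.injective h))
  have hc : ⟪perp (t.vtx j - t.vtx i), emid (t.vtx i, t.vtx j) - t.centroid⟫ =
      - crs (t.vtx i - t.vtx k) (t.vtx j - t.vtx k) / 3 := by
    rw [inner_perp, centroid_eq, sum_perm t i j k hij hik hjk, emid, midpoint_eq_smul_add]
    simp [crs]
    ring
  unfold Tri.nrm
  simp only [hc]
  by_cases h : crs (t.vtx i - t.vtx k) (t.vtx j - t.vtx k) ≤ 0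
  · rw [if_pos (by linarith), if_pos h, smul_smul, mul_inv_cancel₀ hne]
  · rw [if_neg (by linarith), if_neg h, smul_neg, smul_smul, mul_inv_cancel₀ hne]
    simp

theorem hasEdge_iff (t : Tri) (σ : E2 × E2) (h : t.hasEdge σ) :
    ∃ i j k : Fin 3, i ≠ j ∧ i ≠ k ∧ j ≠ k ∧ σ = (t.vtx i, t.vtx j) := by
  obtain ⟨hne, ⟨i, hi⟩, ⟨j, hj⟩⟩ := h
  have hij : i ≠ j := by
    rintro rfl
    exact hne (hi.symm.trans hj)
  have : ∀ i j : Fin 3, i ≠ j → ∃ k, i ≠ k ∧ j ≠ k := by decide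
  obtain ⟨k, h1, h2⟩ := this i j hij
  exact ⟨i, j, k, hij, h1, h2, by rw [hi, hj]⟩

theorem perp_neg' (u w : E2) : perp (u - w) = - perp (w - u) := by
  ext i
  fin_cases i <;> simp [perp]

theorem elen_swap (σ : E2 × E2) : elen σ.swap = elen σ := dist_comm _ _

theorem emid_swap (σ : E2 × E2) : emid σ.swap = emid σ := midpoint_comm _ _

theorem nrm_swap (t : Tri) (σ : E2 × E2) (h : t.hasEdge σ) :
    elen σ.swap • t.nrm σ.swap = elen σ • t.nrm σ := by
  obtain ⟨i, j, k, hij, hik, hjk, rfl⟩ := hasEdge_iff t σ h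
  have h1 := nrm_eq t i j k hij hik hjk
  have h2 := nrm_eq t j i k hij.symm hjk hik
  have hne := crs_ne' t i j k hij hik hjk
  have ha : crs (t.vtx j - t.vtx k) (t.vtx i - t.vtx k)
      = - crs (t.vtx i - t.vtx k) (t.vtx j - t.vtx k) := by unfold crs; ring
  rw [ha] at h2
  simp only [Prod.swap_prod_mk]
  rw [h1, h2, perp_neg']
  rcases lt_or_gt_of_ne hne with h | h
  · rw [if_neg (by linarith), if_pos h.le]; simp
  · rw [if_pos (by linarith), if_neg (by linarith)]; simp

theorem gradA_inner (q : E2 →ᵃ[ℝ] ℝ) (x y : E2) : q x - q y = ⟪gradA q, x - y⟫ := by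
  unfold gradA
  rw [InnerProductSpace.toDual_symm_apply]
  have := q.linearMap_vsub x y
  simpa using this.symm

theorem green (t : Tri) (q : E2 →ᵃ[ℝ] ℝ) (w : E2) :
    t.area * ⟪w, gradA q⟫ =
      q (emid (t.vtx 0, t.vtx 1)) * ⟪w, elen (t.vtx 0, t.vtx 1) • t.nrm (t.vtx 0, t.vtx 1)⟫
      + q (emid (t.vtx 1, t.vtx 2)) * ⟪w, elen (t.vtx 1, t.vtx 2) • t.nrm (t.vtx 1, t.vtx 2)⟫
      + q (emid (t.vtx 2, t.vtx 0)) * ⟪w, elen (t.vtx 2, t.vtx 0) • t.nrm (t.vtx 2, t.vtx 0)⟫ := by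
  rw [nrm_eq t 0 1 2 (by decide) (by decide) (by decide),
    nrm_eq t 1 2 0 (by decide) (by decide) (by decide),
    nrm_eq t 2 0 1 (by decide) (by decide) (by decide), area_eq]
  simp only [emid_affine]
  have e1 : crs (t.vtx 0 - t.vtx 2) (t.vtx 1 - t.vtx 2) =
      crs (t.vtx 1 - t.vtx 0) (t.vtx 2 - t.vtx 0) := by simp [crs]; ring
  have e2 : crs (t.vtx 2 - t.vtx 1) (t.vtx 0 - t.vtx 1) =
      crs (t.vtx 1 - t.vtx 0) (t.vtx 2 - t.vtx 0) := by simp [crs]; ring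
  rw [e1, e2]
  have hq1 : q (t.vtx 1) = q (t.vtx 0) + ⟪gradA q, t.vtx 1 - t.vtx 0⟫ := by
    rw [← gradA_inner]; ring
  have hq2 : q (t.vtx 2) = q (t.vtx 0) + ⟪gradA q, t.vtx 2 - t.vtx 0⟫ := by
    rw [← gradA_inner]; ring
  rw [hq1, hq2]
  simp only [inner_smul_right]
  rw [real_inner_comm, real_inner_comm _ w, inner_perp, real_inner_comm _ w, inner_perp,
    real_inner_comm _ w, inner_perp]
  generalize q (t.vtx 0) = q0
  split_ifs with h
  · rw [abs_of_nonpos h]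
    simp [crs, PiLp.inner_apply, Fin.sum_univ_two]
    ring
  · rw [abs_of_pos (not_le.1 h)]
    simp [crs, PiLp.inner_apply, Fin.sum_univ_two]
    ring

/-- The affine basis of the vertices. -/
def tbasis (t : Tri) : AffineBasis (Fin 3) ℝ E2 :=
  ⟨t.vtx, t.indep, by
    rw [t.indep.affineSpan_eq_top_iff_card_eq_finrank_add_one]; simp⟩

theorem tbasis_apply (t : Tri) (i : Fin 3) : tbasis t i = t.vtx i := rfl

theorem interior_eq (t : Tri) :
    interior t.carrier = {x | ∀ i, 0 < (tbasis t).coord i x} :=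
  (tbasis t).interior_convexHull

theorem coord_crs (t : Tri) (i j k : Fin 3) (hij : i ≠ j) (hik : i ≠ k) (hjk : j ≠ k) (y : E2) :
    crs (t.vtx i - y) (t.vtx j - y) =
      (tbasis t).coord k y * crs (t.vtx i - t.vtx k) (t.vtx j - t.vtx k) := by
  have h : (Finset.univ : Finset (Fin 3)) = {i, j, k} := by
    revert i j k; decide
  have e1 := (tbasis t).linear_combination_coord_eq_self y
  have e2 := (tbasis t).sum_coord_apply_eq_one y
  rw [h, Finset.sum_insert (by simp [hij, hik]), Finset.sum_insert (by simp [hjk]),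
    Finset.sum_singleton] at e1 e2
  simp only [tbasis_apply] at e1
  generalize (tbasis t).coord i y = a at *
  generalize (tbasis t).coord j y = b at *
  generalize (tbasis t).coord k y = c at *
  obtain rfl : a = 1 - b - c := by linarith
  rw [← e1]
  simp [crs]
  ring

/-- Points close to the midpoint of an edge, in the direction of a point on the right side,
are in the interior. -/
theorem near_mid (t : Tri) (i j k : Fin 3) (hij : i ≠ j) (hik : i ≠ k) (hjk : j ≠ k) (y : E2)
    (hy : 0 < (tbasis t).coord k y) :
    ∀ᶠ ε in nhdsWithin (0 : ℝ) (Set.Ioi 0),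
      AffineMap.lineMap (emid (t.vtx i, t.vtx j)) y ε ∈ interior t.carrier := by
  rw [interior_eq]
  simp only [Set.mem_ofPred_eq]
  rw [Filter.eventually_all]
  have hmid : ∀ l, (tbasis t).coord l (emid (t.vtx i, t.vtx j)) =
      ((if l = i then 1 else 0) + (if l = j then 1 else 0)) / 2 := by
    intro l
    rw [emid_affine, ← tbasis_apply, ← tbasis_apply, AffineBasis.coord_apply,
      AffineBasis.coord_apply]
  have hl : ∀ l (ε : ℝ), (tbasis t).coord l (AffineMap.lineMap (emid (t.vtx i, t.vtx j)) y ε) =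
      (1 - ε) * (tbasis t).coord l (emid (t.vtx i, t.vtx j)) + ε * (tbasis t).coord l y := by
    intro l ε
    rw [AffineMap.apply_lineMap, AffineMap.lineMap_apply_ring']
    ring
  have hcases : ∀ l, l = i ∨ l = j ∨ l = k := by clear hmid hl hy; revert i j k; decide
  intro l
  have hpos : 0 < (tbasis t).coord l (emid (t.vtx i, t.vtx j)) → ∀ᶠ ε in nhdsWithin (0 : ℝ) (Set.Ioi 0),
      0 < (tbasis t).coord l (AffineMap.lineMap (emid (t.vtx i, t.vtx j)) y ε) := by
    intro h
    apply Filter.Eventually.filter_mono nhdsWithin_le_nhds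
    simp only [hl]
    have hc : Continuous fun ε : ℝ => (1 - ε) * (tbasis t).coord l (emid (t.vtx i, t.vtx j))
      + ε * (tbasis t).coord l y := by fun_prop
    exact hc.continuousAt.eventually_const_lt (by simpa using h)
  rcases hcases l with rfl | rfl | rfl
  · apply hpos
    rw [hmid]; simp [hij]
  · apply hpos
    rw [hmid]; simp [hij.symm]
  · filter_upwards [self_mem_nhdsWithin] with ε hε
    rw [hl, hmid]
    simp [hik.symm, hjk.symm]
    exact mul_pos hε hy

theorem nrm_opp (t₁ t₂ : Tri) (hd : interior t₁.carrier ∩ interior t₂.carrier = ∅)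
    (σ : E2 × E2) (h₁ : t₁.hasEdge σ) (h₂ : t₂.hasEdge σ) :
    elen σ • t₂.nrm σ = - (elen σ • t₁.nrm σ) := by
  obtain ⟨i, j, k, hij, hik, hjk, rfl⟩ := hasEdge_iff t₁ σ h₁
  obtain ⟨i', j', k', hij', hik', hjk', he⟩ := hasEdge_iff t₂ _ h₂
  have hpi : t₁.vtx i = t₂.vtx i' := congrArg Prod.fst he
  have hpj : t₁.vtx j = t₂.vtx j' := congrArg Prod.snd he
  have n1 := nrm_eq t₁ i j k hij hik hjk
  have n2 := nrm_eq t₂ i' j' k' hij' hik' hjk'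
  have c1 := crs_ne' t₁ i j k hij hik hjk
  have c2 := crs_ne' t₂ i' j' k' hij' hik' hjk'
  have hcc := coord_crs t₂ i' j' k' hij' hik' hjk' (t₁.vtx k)
  have key : ¬ 0 < (tbasis t₂).coord k' (t₁.vtx k) := by
    intro hpos
    have a1 := near_mid t₁ i j k hij hik hjk (t₁.vtx k) (by
      rw [← tbasis_apply, AffineBasis.coord_apply]; simp)
    have a2 := near_mid t₂ i' j' k' hij' hik' hjk' (t₁.vtx k) hpos
    rw [← hpi, ← hpj] at a2
    obtain ⟨ε, b1, b2⟩ := (a1.and a2).exists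
    have : AffineMap.lineMap (emid (t₁.vtx i, t₁.vtx j)) (t₁.vtx k) ε ∈
      interior t₁.carrier ∩ interior t₂.carrier := ⟨b1, b2⟩
    rw [hd] at this
    exact this
  rw [← hpi, ← hpj] at n2 c2 hcc
  rw [n1, n2]
  rcases lt_or_gt_of_ne c1 with h | h <;> rcases lt_or_gt_of_ne c2 with h' | h'
  · exact absurd (by nlinarith) key
  · rw [if_pos h.le, if_neg (by linarith)]; simp
  · rw [if_pos h'.le, if_neg (by linarith)]; simp
  · exact absurd (by nlinarith) key

theorem sum_edges {Ω : Set E2} (M : Mesh Ω) (t : Tri) (ht : t ∈ M.tris) (F : E2 × E2 → ℝ)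
    (hF : ∀ σ, t.hasEdge σ → F σ.swap = F σ) :
    ∑ σ ∈ M.edges with t.hasEdge σ, F σ =
      F (t.vtx 0, t.vtx 1) + F (t.vtx 1, t.vtx 2) + F (t.vtx 2, t.vtx 0) := by
  have hinj := t.indep.injective
  have hE : ∀ i j : Fin 3, i ≠ j → t.hasEdge (t.vtx i, t.vtx j) := fun i j hij =>
    ⟨fun h => hij (hinj h), ⟨i, rfl⟩, ⟨j, rfl⟩⟩
  -- the registered version of an edge
  have hreg : ∀ i j : Fin 3, i ≠ j → ∃ e : E2 × E2, e ∈ M.edges ∧ F e = F (t.vtx i, t.vtx j) ∧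
      (e = (t.vtx i, t.vtx j) ∨ e = (t.vtx j, t.vtx i)) ∧
      ((t.vtx i, t.vtx j) ∈ M.edges → (t.vtx i, t.vtx j) = e) ∧
      ((t.vtx j, t.vtx i) ∈ M.edges → (t.vtx j, t.vtx i) = e) := by
    intro i j hij
    rcases M.edges_cover t ht i j hij with h | h
    · exact ⟨_, h, rfl, Or.inl rfl, fun _ => rfl, fun h' => absurd h' (M.edges_orient _ h)⟩
    · exact ⟨_, h, hF _ (hE i j hij), Or.inr rfl,
        fun h' => absurd h' (M.edges_orient _ h), fun _ => rfl⟩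
  obtain ⟨e1, m1, f1, d1, u1, w1⟩ := hreg 0 1 (by decide)
  obtain ⟨e2, m2, f2, d2, u2, w2⟩ := hreg 1 2 (by decide)
  obtain ⟨e3, m3, f3, d3, u3, w3⟩ := hreg 2 0 (by decide)
  have h01 : t.vtx 0 ≠ t.vtx 1 := fun h => absurd (hinj h) (by decide)
  have h02 : t.vtx 0 ≠ t.vtx 2 := fun h => absurd (hinj h) (by decide)
  have h12 : t.vtx 1 ≠ t.vtx 2 := fun h => absurd (hinj h) (by decide)
  have n12 : e1 ≠ e2 := by
    rcases d1 with rfl | rfl <;> rcases d2 with rfl | rfl <;> simp [h01, h02, h12, Ne.symm]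
  have n13 : e1 ≠ e3 := by
    rcases d1 with rfl | rfl <;> rcases d3 with rfl | rfl <;> simp [h01, h02, h12, h01.symm, h12.symm]
  have n23 : e2 ≠ e3 := by
    rcases d2 with rfl | rfl <;> rcases d3 with rfl | rfl <;> simp [h01.symm, h02.symm, h12, h12.symm]
  have hset : M.edges.filter (fun σ => t.hasEdge σ) = {e1, e2, e3} := by
    ext σ
    simp only [Finset.mem_filter, Finset.mem_insert, Finset.mem_singleton]
    constructor
    · rintro ⟨hσ, hs⟩
      obtain ⟨i, j, k, hij, hik, hjk, rfl⟩ := hasEdge_iff t σ hs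
      fin_cases i <;> fin_cases j <;> first | exact absurd rfl hij | skip
      · exact Or.inl (u1 hσ)
      · exact Or.inr (Or.inr (w3 hσ))
      · exact Or.inl (w1 hσ)
      · exact Or.inr (Or.inl (u2 hσ))
      · exact Or.inr (Or.inr (u3 hσ))
      · exact Or.inr (Or.inl (w2 hσ))
    · rintro (rfl | rfl | rfl)
      · exact ⟨m1, by rcases d1 with rfl | rfl <;> exact hE _ _ (by decide)⟩
      · exact ⟨m2, by rcases d2 with rfl | rfl <;> exact hE _ _ (by decide)⟩
      · exact ⟨m3, by rcases d3 with rfl | rfl <;> exact hE _ _ (by decide)⟩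
  rw [hset, Finset.sum_insert (by simp [n12, n13]), Finset.sum_insert (by simp [n23]),
    Finset.sum_singleton, f1, f2, f3, add_assoc]

theorem area_pos (t : Tri) : 0 < t.area := by
  rw [area_eq]
  have := abs_pos.2 (crs_ne t)
  positivity

/-- **Adjointness of the discrete gradient and the discrete divergence**:
for every `v_h ∈ P₀` and every `q_h ∈ P₁^{nc}`,
`(v_h, ∇_h q_h) = −(q_h, div_h v_h)` (L²(Ω) inner products). -/
theorem discrete_grad_div_adjoint
    {Ω : Set E2} (hΩo : IsOpen Ω) (hΩc : IsConnected Ω) (hΩb : Bornology.IsBounded Ω)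
    (M : Mesh Ω) (v : Tri → E2) (q : Tri → (E2 →ᵃ[ℝ] ℝ)) (hq : M.IsP1nc q)
    (d : Tri → (E2 →ᵃ[ℝ] ℝ)) (hd : M.IsDivh v d) :
    M.l2P0 v (gradh q) = - M.l2P1 q d := by
  have hL : M.l2P0 v (gradh q) = ∑ σ ∈ M.edges, ∑ t ∈ M.tris with t.hasEdge σ,
      q t (emid σ) * ⟪v t, elen σ • t.nrm σ⟫ := by
    unfold Mesh.l2P0 gradh
    have : ∀ t ∈ M.tris, t.area * ⟪v t, gradA (q t)⟫ = ∑ σ ∈ M.edges with t.hasEdge σ,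
        q t (emid σ) * ⟪v t, elen σ • t.nrm σ⟫ := by
      intro t ht
      rw [sum_edges M t ht (fun σ => q t (emid σ) * ⟪v t, elen σ • t.nrm σ⟫), green]
      intro σ hσ
      rw [nrm_swap t σ hσ, emid_swap]
    rw [Finset.sum_congr rfl this]
    simp only [Finset.sum_filter]
    exact Finset.sum_comm
  have hR : M.l2P1 q d = ∑ σ ∈ M.edges, ∑ t ∈ M.tris with t.hasEdge σ,
      t.area / 3 * (q t (emid σ) * d t (emid σ)) := by
    unfold Mesh.l2P1
    have : ∀ t ∈ M.tris, ∫ x in t.carrier, q t x * d t x = ∑ σ ∈ M.edges with t.hasEdge σ,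
        t.area / 3 * (q t (emid σ) * d t (emid σ)) := by
      intro t ht
      rw [sum_edges M t ht (fun σ => t.area / 3 * (q t (emid σ) * d t (emid σ))), midpoint_rule]
      · ring
      · intro σ hσ
        rw [emid_swap]
    rw [Finset.sum_congr rfl this]
    simp only [Finset.sum_filter]
    exact Finset.sum_comm
  rw [hL, hR, ← Finset.sum_neg_distrib]
  apply Finset.sum_congr rfl
  intro σ hσ
  obtain ⟨hK, hKe⟩ := M.Kof_mem σ hσ
  have hKpos := area_pos (M.Kof σ)
  have hKm : M.Kof σ ∈ M.tris.filter (fun t => t.hasEdge σ) := by simp [hK, hKe]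
  by_cases hc : (M.tris.filter fun t => t.hasEdge σ).card = 2
  · obtain ⟨hLt, hLe, hne⟩ := M.Lof_mem σ hσ hc
    have hLpos := area_pos (M.Lof σ)
    have hset : M.tris.filter (fun t => t.hasEdge σ) = {M.Kof σ, M.Lof σ} := by
      symm
      apply Finset.eq_of_subset_of_card_le
      · intro t ht
        simp only [Finset.mem_insert, Finset.mem_singleton] at ht
        rcases ht with rfl | rfl
        · exact hKm
        · simp [hLt, hLe]
      · rw [hc, Finset.card_pair hne.symm]
    have hdK := hd.2 _ hK σ hσ hKe
    have hdL := hd.2 _ hLt σ hσ hLe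
    have hqq := hq σ (by simp [Mesh.intEdges, hσ, hc])
    have hdv : M.divhImage v σ = (3 * elen σ / ((M.Kof σ).area + (M.Lof σ).area)) *
      ⟪v (M.Lof σ) - v (M.Kof σ), (M.Kof σ).nrm σ⟫ := by
      unfold Mesh.divhImage; rw [if_pos hc]
    have hopp := nrm_opp _ _ (M.interior_disjoint _ hK _ hLt hne.symm) σ hKe hLe
    rw [hset, Finset.sum_pair hne.symm, Finset.sum_pair hne.symm, hopp, hdK, hdL, ← hqq, hdv]
    simp only [inner_neg_right, inner_smul_right, inner_sub_left]
    field_simp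
    ring
  · have hc1 : (M.tris.filter fun t => t.hasEdge σ).card = 1 := by
      have h2 := M.edges_atMostTwo σ hσ
      have h1 := Finset.card_pos.2 ⟨_, hKm⟩
      omega
    have hset : M.tris.filter (fun t => t.hasEdge σ) = {M.Kof σ} := by
      obtain ⟨a, ha⟩ := Finset.card_eq_one.1 hc1
      rw [ha] at hKm ⊢
      rw [Finset.mem_singleton.1 hKm]
    have hdK := hd.2 _ hK σ hσ hKe
    have hdv : M.divhImage v σ =
        -((3 * elen σ / (M.Kof σ).area) * ⟪v (M.Kof σ), (M.Kof σ).nrm σ⟫) := by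
      unfold Mesh.divhImage; rw [if_neg hc]
    rw [hset, Finset.sum_singleton, Finset.sum_singleton, hdK, hdv]
    simp only [inner_smul_right]
    field_simp

end
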